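/- arXiv:2112.06236 — 4 statements merged into one kernel-verified Lean document; each statement's English description precedes it below -/
import Mathlib

section
/- Let G be a finite group and let H ≤ A ≤ G be subgroups. Then A is a perfect code of the pair (G,H) if and only if there exists a left transversal X of A in G such that XH = HX⁻¹ (where XH = {xh : x ∈ X, h ∈ H} and HX⁻¹ = {hx⁻¹ : h ∈ H, x ∈ X}). -/
open scoped Pointwise

/-- A perfect code in a graph: an independent set `C` of vertices such that every
vertex outside of `C` is adjacent to exactly one vertex in `C`. -/
def IsPerfectCode {V : Type*} (Γ : SimpleGraph V) (C : Set V) : Prop :=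
  (∀ a ∈ C, ∀ b ∈ C, ¬ Γ.Adj a b) ∧ ∀ v ∉ C, ∃! c, c ∈ C ∧ Γ.Adj v c

/-- A total perfect code in a graph: a set `C` of vertices such that every vertex
of the graph is adjacent to exactly one vertex in `C`. -/
def IsTotalPerfectCode {V : Type*} (Γ : SimpleGraph V) (C : Set V) : Prop :=
  ∀ v, ∃! c, c ∈ C ∧ Γ.Adj v c

/-- The coset graph `Cos(G,H,U)`: vertices are the left cosets of `H` in `G`, and
`g₁H` is adjacent to `g₂H` iff `g₁⁻¹ * g₂ ∈ U`.  (When `HUH = U`, `H ∩ U = ∅` and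
`U⁻¹ = U`, this matches the usual definition.) -/
def cosetGraph {G : Type*} [Group G] (H : Subgroup G) (U : Set G) :
    SimpleGraph (G ⧸ H) :=
  SimpleGraph.fromRel fun x y =>
    ∃ g₁ g₂ : G, QuotientGroup.mk g₁ = x ∧ QuotientGroup.mk g₂ = y ∧ g₁⁻¹ * g₂ ∈ U

/-- `A` is a perfect code of the pair `(G,H)`: there is `U ⊆ G` with `HUH = U`,
`H ∩ U = ∅`, `U⁻¹ = U` such that `A/H = {aH : a ∈ A}` is a perfect code in the
coset graph `Cos(G,H,U)`. -/
def IsPerfectCodePair {G : Type*} [Group G] (H A : Subgroup G) : Prop :=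
  ∃ U : Set G,
    (H : Set G) * U * (H : Set G) = U ∧
    (H : Set G) ∩ U = ∅ ∧
    U⁻¹ = U ∧
    IsPerfectCode (cosetGraph H U) ((QuotientGroup.mk : G → G ⧸ H) '' (A : Set G))

/-- `A` is a total perfect code of the pair `(G,H)`. -/
def IsTotalPerfectCodePair {G : Type*} [Group G] (H A : Subgroup G) : Prop :=
  ∃ U : Set G,
    (H : Set G) * U * (H : Set G) = U ∧
    (H : Set G) ∩ U = ∅ ∧
    U⁻¹ = U ∧
    IsTotalPerfectCode (cosetGraph H U) ((QuotientGroup.mk : G → G ⧸ H) '' (A : Set G))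

/-- A left transversal of `A` in `G`: a set containing exactly one element of each
left coset of `A`. -/
def IsLeftTransversal {G : Type*} [Group G] (X : Set G) (A : Subgroup G) : Prop :=
  ∀ g : G, ∃! x, x ∈ X ∧ g⁻¹ * x ∈ A

/-- A right transversal of `A` in `G`: a set containing exactly one element of each
right coset of `A`. -/
def IsRightTransversal {G : Type*} [Group G] (Y : Set G) (A : Subgroup G) : Prop :=
  ∀ g : G, ∃! y, y ∈ Y ∧ y * g⁻¹ ∈ A

theorem cosetGraph_adj_mk {G : Type*} [Group G] {H : Subgroup G} {U : Set G}
    (hU : (H : Set G) * U * (H : Set G) = U) (hd : (H : Set G) ∩ U = ∅) (hi : U⁻¹ = U)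
    (a b : G) :
    (cosetGraph H U).Adj (QuotientGroup.mk a) (QuotientGroup.mk b) ↔ a⁻¹ * b ∈ U := by
  have inv_mem : ∀ u ∈ U, u⁻¹ ∈ U := fun u hu => by
    rw [← hi]; simpa using hu
  have key : ∀ a b : G, (∃ g₁ g₂ : G, (QuotientGroup.mk g₁ : G ⧸ H) = QuotientGroup.mk a ∧
      (QuotientGroup.mk g₂ : G ⧸ H) = QuotientGroup.mk b ∧ g₁⁻¹ * g₂ ∈ U) → a⁻¹ * b ∈ U := by
    rintro a b ⟨g₁, g₂, h₁, h₂, h⟩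
    rw [eq_comm, QuotientGroup.eq] at h₁
    rw [QuotientGroup.eq] at h₂
    rw [← hU]
    exact ⟨_, ⟨_, h₁, _, h, rfl⟩, _, h₂, by simp [mul_assoc]⟩
  unfold cosetGraph
  rw [SimpleGraph.fromRel_adj]
  constructor
  · rintro ⟨-, h | h⟩
    · exact key _ _ h
    · simpa using inv_mem _ (key _ _ h)
  · refine fun h => ⟨fun e => ?_, Or.inl ⟨a, b, rfl, rfl, h⟩⟩
    rw [QuotientGroup.eq] at e
    exact (Set.eq_empty_iff_forall_notMem.mp hd) _ ⟨e, h⟩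

/-- An inverse-closed union of left cosets of `H` which meets each left coset of `A` in exactly
one left coset of `H` is `X * H` for some left transversal `X` of `A`. -/
theorem exists_isLeftTransversal_mul_eq {G : Type*} [Group G] {H A : Subgroup G} {W : Set G}
    (hW : ∀ w ∈ W, ∀ h ∈ H, w * h ∈ W) (hi : W⁻¹ = W)
    (hex : ∀ g : G, ∃ w ∈ W, g⁻¹ * w ∈ A)
    (huniq : ∀ v ∈ W, ∀ w ∈ W, v⁻¹ * w ∈ A → v⁻¹ * w ∈ H) :
    ∃ X : Set G, IsLeftTransversal X A ∧ X * (H : Set G) = (H : Set G) * X⁻¹ := by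
  have hsec : ∀ q : G ⧸ A, ∃ w ∈ W, (QuotientGroup.mk w : G ⧸ A) = q := by
    intro q
    obtain ⟨g, rfl⟩ := QuotientGroup.mk_surjective q
    obtain ⟨w, hw, hg⟩ := hex g
    exact ⟨w, hw, (QuotientGroup.eq.mpr hg).symm⟩
  choose s hs hsq using hsec
  have hXH : Set.range s * (H : Set G) = W := by
    ext w
    constructor
    · rintro ⟨_, ⟨q, rfl⟩, h, hh, rfl⟩
      exact hW _ (hs q) _ hh
    · intro hw
      exact ⟨_, ⟨QuotientGroup.mk w, rfl⟩, _,
        huniq _ (hs _) _ hw (QuotientGroup.eq.mp (hsq _)), by simp⟩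
  refine ⟨Set.range s, fun g => ⟨s (QuotientGroup.mk g), ⟨⟨_, rfl⟩, ?_⟩, ?_⟩, ?_⟩
  · exact QuotientGroup.eq.mp (hsq _).symm
  · rintro _ ⟨⟨q, rfl⟩, hq⟩
    rw [QuotientGroup.eq.mpr hq, hsq]
  · have h := congrArg (·⁻¹) hXH
    simp only [mul_inv_rev, inv_coe_set, hi] at h
    rw [hXH, h]

theorem IsPerfectCodePair.exists_isLeftTransversal {G : Type*} [Group G] {H A : Subgroup G}
    (hHA : H ≤ A) (hA : IsPerfectCodePair H A) :
    ∃ X : Set G, IsLeftTransversal X A ∧ X * (H : Set G) = (H : Set G) * X⁻¹ := by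
  obtain ⟨U, hU, hd, hi, hind, hdom⟩ := hA
  have adj := cosetGraph_adj_mk hU hd hi
  have inv_mem : ∀ u ∈ U, u⁻¹ ∈ U := fun u hu => by
    rw [← hi]; simpa using hu
  have hUA : ∀ u ∈ U, u ∉ A := fun u hu ha =>
    hind _ ⟨1, A.one_mem, rfl⟩ _ ⟨u, ha, rfl⟩ ((adj 1 u).mpr (by simpa using hu))
  have hmk : ∀ g ∉ A, (QuotientGroup.mk g : G ⧸ H) ∉ QuotientGroup.mk '' (A : Set G) := by
    rintro g hg ⟨a, ha, e⟩
    exact hg (by simpa using A.mul_mem ha (hHA (QuotientGroup.eq.mp e)))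
  refine exists_isLeftTransversal_mul_eq (W := U ∪ H) ?_ ?_ ?_ ?_
  · rintro w (hw | hw) h hh
    · left
      rw [← hU]
      exact ⟨w, ⟨1, H.one_mem, w, hw, by simp⟩, h, hh, rfl⟩
    · exact Or.inr (H.mul_mem hw hh)
  · rw [Set.union_inv, hi, inv_coe_set]
  · intro g
    by_cases hg : g ∈ A
    · exact ⟨1, Or.inr H.one_mem, by simpa using hg⟩
    · obtain ⟨_, ⟨⟨a, ha, rfl⟩, hadj⟩, -⟩ := hdom _ (hmk g⁻¹ (by simpa using hg))
      rw [adj, inv_inv] at hadj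
      exact ⟨g * a, Or.inl hadj, by simpa using ha⟩
  · intro v hv w hw hvw
    rcases hv with hv | hv
    · rcases hw with hw | hw
      · obtain ⟨_, -, h⟩ := hdom _ (hmk v⁻¹ (by simpa using hUA v hv))
        have h₁ := h (QuotientGroup.mk 1) ⟨⟨1, A.one_mem, rfl⟩, by rw [adj]; simpa using hv⟩
        have h₂ := h (QuotientGroup.mk (v⁻¹ * w)) ⟨⟨_, hvw, rfl⟩, by rw [adj]; simpa using hw⟩
        simpa using QuotientGroup.eq.mp (h₁.trans h₂.symm)
      · refine absurd ?_ (hUA _ (inv_mem v hv))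
        simpa using A.mul_mem hvw (A.inv_mem (hHA hw))
    · rcases hw with hw | hw
      · refine absurd ?_ (hUA w hw)
        simpa using A.mul_mem (hHA hv) hvw
      · exact H.mul_mem (H.inv_mem hv) hw

theorem IsLeftTransversal.isPerfectCodePair {G : Type*} [Group G] {H A : Subgroup G}
    (hHA : H ≤ A) {X : Set G} (hX : IsLeftTransversal X A)
    (hXH : X * (H : Set G) = (H : Set G) * X⁻¹) : IsPerfectCodePair H A := by
  have hWr : ∀ w ∈ X * (H : Set G), ∀ h ∈ H, w * h ∈ X * (H : Set G) := by
    rintro _ ⟨x, hx, k, hk, rfl⟩ h hh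
    exact ⟨x, hx, k * h, H.mul_mem hk hh, by simp [mul_assoc]⟩
  have hWi : (X * (H : Set G))⁻¹ = X * (H : Set G) := by
    rw [mul_inv_rev, inv_coe_set, hXH]
  have hWinv : ∀ w ∈ X * (H : Set G), w⁻¹ ∈ X * (H : Set G) := fun w hw => by
    rw [← Set.mem_inv, hWi]; exact hw
  have hWl : ∀ h ∈ H, ∀ w ∈ X * (H : Set G), h * w ∈ X * (H : Set G) := fun h hh w hw => by
    simpa using hWinv _ (hWr _ (hWinv w hw) _ (H.inv_mem hh))
  have hU : (H : Set G) * ((X * (H : Set G)) \ A) * (H : Set G) = (X * (H : Set G)) \ A := by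
    ext g
    constructor
    · rintro ⟨_, ⟨h, hh, w, ⟨hw, hwA⟩, rfl⟩, k, hk, rfl⟩
      refine ⟨hWr _ (hWl h hh w hw) k hk, fun hA => hwA ?_⟩
      exact (A.mul_mem_cancel_left (hHA hh)).mp ((A.mul_mem_cancel_right (hHA hk)).mp hA)
    · exact fun hg => ⟨g, ⟨1, H.one_mem, g, hg, by simp⟩, 1, H.one_mem, by simp⟩
  have hd : (H : Set G) ∩ ((X * (H : Set G)) \ A) = ∅ :=
    Set.eq_empty_iff_forall_notMem.mpr fun g hg => hg.2.2 (hHA hg.1)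
  have hi : ((X * (H : Set G)) \ A)⁻¹ = (X * (H : Set G)) \ A := by
    ext g
    rw [Set.mem_inv, Set.mem_sdiff, Set.mem_sdiff, ← Set.mem_inv, hWi]
    simp
  have adj := cosetGraph_adj_mk hU hd hi
  refine ⟨_, hU, hd, hi, ?_, ?_⟩
  · rintro _ ⟨a, ha, rfl⟩ _ ⟨b, hb, rfl⟩ h
    exact ((adj a b).mp h).2 (A.mul_mem (A.inv_mem ha) hb)
  · intro v hv
    obtain ⟨g, rfl⟩ := QuotientGroup.mk_surjective v
    have hg : g ∉ A := fun h => hv ⟨g, h, rfl⟩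
    have hgA : ∀ a ∈ A, g⁻¹ * a ∉ A := fun a ha h =>
      hg (by simpa using (A.mul_mem_cancel_right ha).mp h)
    obtain ⟨x, ⟨hx, hxA⟩, huniq⟩ := hX g⁻¹
    rw [inv_inv] at hxA
    refine ⟨QuotientGroup.mk (g * x), ⟨⟨_, hxA, rfl⟩, ?_⟩, ?_⟩
    · rw [adj]
      exact ⟨⟨x, hx, 1, H.one_mem, by simp⟩, hgA _ hxA⟩
    · rintro _ ⟨⟨a, ha, rfl⟩, h⟩
      obtain ⟨⟨y, hy, k, hk, e⟩, -⟩ := (adj g a).mp h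
      have ea : a = g * y * k := by
        rw [mul_assoc]
        exact (mul_eq_of_eq_inv_mul e).symm
      subst ea
      have hyx : y = x := huniq y ⟨hy, by
        simpa using (A.mul_mem_cancel_right (hHA hk)).mp ha⟩
      subst hyx
      exact (QuotientGroup.eq.mpr (by simpa [mul_assoc] using hk)).symm

/-- `A` is a perfect code of `(G,H)` iff there is a left transversal `X`
of `A` in `G` with `XH = HX⁻¹`. -/
theorem perfectCodePair_iff_exists_leftTransversal
    {G : Type*} [Group G] [Finite G] (H A : Subgroup G) (hHA : H ≤ A) :
    IsPerfectCodePair H A ↔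
      ∃ X : Set G, IsLeftTransversal X A ∧ X * (H : Set G) = (H : Set G) * X⁻¹ :=
  ⟨fun h => h.exists_isLeftTransversal hHA, fun ⟨_, hX, hXH⟩ => hX.isPerfectCodePair hHA hXH⟩
end

section
/- Let G be a finite group and let H ≤ A ≤ G be subgroups. Then A is a perfect code of the pair (G,H) if and only if there exists a right transversal Y of A in G such that Y⁻¹H = HY (where Y⁻¹H = {y⁻¹h : y ∈ Y, h ∈ H} and HY = {hy : h ∈ H, y ∈ Y}). -/
open scoped Pointwise

section CosetGraph

variable {G : Type*} [Group G] {H A : Subgroup G} {U V Y : Set G}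

theorem mul_mul_mem_of_mul_mul_eq (hU : (H : Set G) * U * (H : Set G) = U) {h u k : G}
    (hh : h ∈ H) (hu : u ∈ U) (hk : k ∈ H) : h * u * k ∈ U :=
  hU ▸ Set.mul_mem_mul (Set.mul_mem_mul hh hu) hk

theorem cosetGraph_adj_mk_iff (hU : (H : Set G) * U * (H : Set G) = U)
    (hHU : (H : Set G) ∩ U = ∅) (hinv : U⁻¹ = U) (x y : G) :
    (cosetGraph H U).Adj (x : G ⧸ H) (y : G ⧸ H) ↔ x⁻¹ * y ∈ U := by
  have key : ∀ a b : G, (∃ g₁ g₂ : G, (g₁ : G ⧸ H) = a ∧ (g₂ : G ⧸ H) = b ∧ g₁⁻¹ * g₂ ∈ U) →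
      a⁻¹ * b ∈ U := by
    rintro a b ⟨g₁, g₂, h₁, h₂, hu⟩
    have := mul_mul_mem_of_mul_mul_eq hU (QuotientGroup.eq.1 h₁.symm) hu (QuotientGroup.eq.1 h₂)
    simpa [mul_assoc] using this
  simp only [cosetGraph, SimpleGraph.fromRel_adj]
  constructor
  · rintro ⟨-, h | h⟩
    · exact key x y h
    · rw [← hinv]
      simpa using key y x h
  · refine fun h => ⟨fun hxy => ?_, Or.inl ⟨x, y, rfl, rfl, h⟩⟩
    exact Set.eq_empty_iff_forall_notMem.1 hHU _ ⟨QuotientGroup.eq.1 hxy, h⟩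

theorem mk_mem_image_coe_iff (hHA : H ≤ A) (g : G) :
    (g : G ⧸ H) ∈ (QuotientGroup.mk : G → G ⧸ H) '' (A : Set G) ↔ g ∈ A := by
  refine ⟨?_, fun h => ⟨g, h, rfl⟩⟩
  rintro ⟨a, ha, hag⟩
  simpa using A.mul_mem ha (hHA (QuotientGroup.eq.1 hag))

/-- `A/H` is a perfect code of `Cos(G,H,U)` iff `U` avoids `A` and meets every other right coset
of `A` in exactly one right coset of `H`. -/
theorem isPerfectCode_cosetGraph_iff (hHA : H ≤ A) (hU : (H : Set G) * U * (H : Set G) = U)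
    (hHU : (H : Set G) ∩ U = ∅) (hinv : U⁻¹ = U) :
    IsPerfectCode (cosetGraph H U) ((QuotientGroup.mk : G → G ⧸ H) '' (A : Set G)) ↔
      (∀ u ∈ U, u ∉ A) ∧
        ∀ g ∉ A, ∃ u ∈ U, u * g⁻¹ ∈ A ∧ ∀ v ∈ U, v * g⁻¹ ∈ A → v * u⁻¹ ∈ H := by
  have hadj := cosetGraph_adj_mk_iff hU hHU hinv
  have hmem : ∀ {u}, u ∈ U → u⁻¹ ∈ U := fun {u} hu => by rwa [← hinv, Set.inv_mem_inv]
  refine and_congr ⟨fun h u hu huA => ?_, ?_⟩ ⟨fun h g hg => ?_, fun h v hv => ?_⟩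
  · exact h _ ⟨1, A.one_mem, rfl⟩ _ ⟨u, huA, rfl⟩ ((hadj 1 u).2 (by simpa using hu))
  · rintro h _ ⟨a, ha, rfl⟩ _ ⟨b, hb, rfl⟩ hab
    exact h _ ((hadj a b).1 hab) (A.mul_mem (A.inv_mem ha) hb)
  · obtain ⟨_, ⟨⟨c, hc, rfl⟩, hgc⟩, huniq⟩ := h (g : G ⧸ H) (by rwa [mk_mem_image_coe_iff hHA])
    refine ⟨c⁻¹ * g, by simpa using hmem ((hadj g c).1 hgc), by simpa using hc, fun v hv hvg => ?_⟩
    have hvA : g * v⁻¹ ∈ A := by simpa using A.inv_mem hvg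
    have := huniq ((g * v⁻¹ : G) : G ⧸ H)
      ⟨⟨_, hvA, rfl⟩, (hadj _ _).2 (by simpa using hmem hv)⟩
    simpa [mul_assoc] using QuotientGroup.eq.1 this
  · induction v using QuotientGroup.induction_on with | H g => ?_
    rw [mk_mem_image_coe_iff hHA] at hv
    obtain ⟨u, hu, hug, huniq⟩ := h g hv
    refine ⟨((g * u⁻¹ : G) : G ⧸ H), ⟨⟨_, by simpa using A.inv_mem hug, rfl⟩,
      (hadj _ _).2 (by simpa using hmem hu)⟩, ?_⟩
    rintro _ ⟨⟨c, hc, rfl⟩, hgc⟩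
    refine QuotientGroup.eq.2 ?_
    have := huniq (c⁻¹ * g) (by simpa using hmem ((hadj g c).1 hgc)) (by simpa using hc)
    simpa [mul_assoc] using this

/-- A union `V` of right cosets of `H`, exactly one in each right coset of `A`, is `HY` for some
right transversal `Y` of `A`. -/
theorem exists_isRightTransversal_mul_eq (hHV : ∀ h ∈ H, ∀ v ∈ V, h * v ∈ V)
    (hV : ∀ g, ∃ y ∈ V, y * g⁻¹ ∈ A ∧ ∀ v ∈ V, v * g⁻¹ ∈ A → v * y⁻¹ ∈ H) :
    ∃ Y : Set G, IsRightTransversal Y A ∧ (H : Set G) * Y = V := by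
  choose f hfV hfA hfH using hV
  have hout : ∀ g : G, g * (Quotient.mk (QuotientGroup.rightRel A) g).out⁻¹ ∈ A := fun g =>
    QuotientGroup.rightRel_apply.1 (Quotient.mk_out (s := QuotientGroup.rightRel A) g)
  refine ⟨Set.range fun q : Quotient (QuotientGroup.rightRel A) => f q.out, fun g => ?_, ?_⟩
  · refine ⟨_, ⟨⟨Quotient.mk (QuotientGroup.rightRel A) g, rfl⟩, ?_⟩, ?_⟩
    · simpa [mul_assoc] using
        A.mul_mem (hfA (Quotient.mk (QuotientGroup.rightRel A) g).out) (A.inv_mem (hout g))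
    · rintro _ ⟨⟨q, rfl⟩, hq⟩
      have : Quotient.mk (QuotientGroup.rightRel A) g = q := by
        rw [← q.out_eq]
        refine Quotient.sound (QuotientGroup.rightRel_apply.2 ?_)
        simpa [mul_assoc] using A.mul_mem (A.inv_mem (hfA q.out)) hq
      rw [this]
  · ext v
    constructor
    · rintro ⟨h, hh, _, ⟨q, rfl⟩, rfl⟩
      exact hHV h hh _ (hfV _)
    · exact fun hv => ⟨_, hfH _ v hv (hout v), _, ⟨Quotient.mk _ v, rfl⟩, by simp⟩

theorem exists_isRightTransversal_of_isPerfectCodePair (hHA : H ≤ A)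
    (h : IsPerfectCodePair H A) :
    ∃ Y : Set G, IsRightTransversal Y A ∧ Y⁻¹ * (H : Set G) = (H : Set G) * Y := by
  obtain ⟨U, hU, hHU, hinv, hcode⟩ := h
  obtain ⟨hUA, hcov⟩ := (isPerfectCode_cosetGraph_iff hHA hU hHU hinv).1 hcode
  obtain ⟨Y, hY, hHY⟩ : ∃ Y : Set G, IsRightTransversal Y A ∧ (H : Set G) * Y = (H : Set G) ∪ U := by
    refine exists_isRightTransversal_mul_eq ?_ fun g => ?_
    · rintro h hh v (hv | hv)
      · exact Or.inl (H.mul_mem hh hv)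
      · exact Or.inr (by simpa using mul_mul_mem_of_mul_mul_eq hU hh hv H.one_mem)
    · by_cases hg : g ∈ A
      · refine ⟨1, Or.inl H.one_mem, by simpa using hg, ?_⟩
        rintro v (hv | hv) hvg
        · simpa using hv
        · exact absurd ((A.mul_mem_cancel_right (A.inv_mem hg)).1 hvg) (hUA v hv)
      · obtain ⟨u, hu, hug, huniq⟩ := hcov g hg
        refine ⟨u, Or.inr hu, hug, ?_⟩
        rintro v (hv | hv) hvg
        · exact absurd (A.inv_mem_iff.1 ((A.mul_mem_cancel_left (hHA hv)).1 hvg)) hg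
        · exact huniq v hv hvg
  refine ⟨Y, hY, ?_⟩
  calc Y⁻¹ * (H : Set G) = ((H : Set G) * Y)⁻¹ := by rw [mul_inv_rev, inv_coe_set]
    _ = (H : Set G) * Y := by rw [hHY, Set.union_inv, inv_coe_set, hinv]

theorem isPerfectCodePair_of_isRightTransversal (hHA : H ≤ A) (hY : IsRightTransversal Y A)
    (hYH : Y⁻¹ * (H : Set G) = (H : Set G) * Y) : IsPerfectCodePair H A := by
  set V : Set G := (H : Set G) * Y with hVdef
  have hVinv : V⁻¹ = V := by rw [hVdef, mul_inv_rev, inv_coe_set, hYH]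
  have hHV : (H : Set G) * V = V := by rw [hVdef, ← mul_assoc, coe_mul_coe]
  have hVH : V * (H : Set G) = V := by rw [← hYH, mul_assoc, coe_mul_coe]
  have hU : (H : Set G) * (V \ A) * (H : Set G) = V \ A := by
    ext u
    constructor
    · rintro ⟨_, ⟨h, hh, v, ⟨hv, hvA⟩, rfl⟩, k, hk, rfl⟩
      refine ⟨hVH ▸ Set.mul_mem_mul (hHV ▸ Set.mul_mem_mul hh hv) hk, fun hA => hvA ?_⟩
      exact (A.mul_mem_cancel_left (hHA hh)).1 ((A.mul_mem_cancel_right (hHA hk)).1 hA)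
    · exact fun hu => ⟨u, ⟨1, H.one_mem, u, hu, one_mul u⟩, 1, H.one_mem, mul_one u⟩
  have hHU : (H : Set G) ∩ (V \ A) = ∅ :=
    Set.eq_empty_iff_forall_notMem.2 fun u hu => hu.2.2 (hHA hu.1)
  have hinv : (V \ A)⁻¹ = V \ (A : Set G) := by
    ext u
    rw [Set.mem_inv, Set.mem_sdiff, Set.mem_sdiff, ← Set.mem_inv, hVinv]
    simp
  refine ⟨V \ A, hU, hHU, hinv, (isPerfectCode_cosetGraph_iff hHA hU hHU hinv).2
    ⟨fun u hu => hu.2, fun g hg => ?_⟩⟩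
  obtain ⟨y, ⟨hyY, hyg⟩, huniq⟩ := hY g
  refine ⟨y, ⟨⟨1, H.one_mem, y, hyY, one_mul y⟩, fun hyA => hg ?_⟩, hyg, ?_⟩
  · exact A.inv_mem_iff.1 ((A.mul_mem_cancel_left hyA).1 hyg)
  · rintro _ ⟨⟨h, hh, z, hz, rfl⟩, -⟩ hzg
    have : z = y := huniq z ⟨hz, by simpa [mul_assoc] using A.mul_mem (A.inv_mem (hHA hh)) hzg⟩
    simpa [this] using hh

end CosetGraph

/-- `A` is a perfect code of `(G,H)` iff there is a right transversal `Y`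
of `A` in `G` with `Y⁻¹H = HY`. -/
theorem perfectCodePair_iff_exists_rightTransversal
    {G : Type*} [Group G] [Finite G] (H A : Subgroup G) (hHA : H ≤ A) :
    IsPerfectCodePair H A ↔
      ∃ Y : Set G, IsRightTransversal Y A ∧ Y⁻¹ * (H : Set G) = (H : Set G) * Y :=
  ⟨exists_isRightTransversal_of_isPerfectCodePair hHA,
    fun ⟨_, hY, hYH⟩ => isPerfectCodePair_of_isRightTransversal hHA hY hYH⟩
end

section
/- Let G be a finite group and let H ≤ A ≤ G be subgroups. If A is a perfect code of the pair (G,H), then for every g ∈ G the conjugate subgroup g⁻¹Ag is a perfect code of the pair (G, g⁻¹Hg). -/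
open scoped Pointwise

theorem IsPerfectCode.image_iso {V W : Type*} {Γ : SimpleGraph V} {Δ : SimpleGraph W}
    {C : Set V} (h : IsPerfectCode Γ C) (φ : Γ ≃g Δ) : IsPerfectCode Δ (φ '' C) := by
  refine ⟨?_, fun w hw => ?_⟩
  · rintro _ ⟨a, ha, rfl⟩ _ ⟨b, hb, rfl⟩ hab
    exact h.1 a ha b hb (φ.map_adj_iff.1 hab)
  · obtain ⟨v, rfl⟩ := φ.surjective w
    obtain ⟨c, ⟨hc, hvc⟩, huniq⟩ := h.2 v fun hv => hw ⟨v, hv, rfl⟩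
    refine ⟨φ c, ⟨⟨c, hc, rfl⟩, φ.map_adj_iff.2 hvc⟩, ?_⟩
    rintro _ ⟨⟨d, hd, rfl⟩, hvd⟩
    exact congrArg φ (huniq d ⟨hd, φ.map_adj_iff.1 hvd⟩)

/-- The bijection between left cosets of `H` and left cosets of the image of `H` under a
group isomorphism. -/
def quotientMapEquiv {G K : Type*} [Group G] [Group K] (e : G ≃* K) (H : Subgroup G) :
    G ⧸ H ≃ K ⧸ H.map e.toMonoidHom :=
  Quotient.congr e.toEquiv fun a b => by
    change QuotientGroup.leftRel H a b ↔ QuotientGroup.leftRel (H.map e.toMonoidHom) (e a) (e b)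
    rw [QuotientGroup.leftRel_apply, QuotientGroup.leftRel_apply, ← map_inv, ← map_mul]
    exact (Subgroup.mem_map_iff_mem (f := e.toMonoidHom) e.injective).symm

@[simp]
theorem quotientMapEquiv_mk {G K : Type*} [Group G] [Group K] (e : G ≃* K) (H : Subgroup G)
    (a : G) : quotientMapEquiv e H (QuotientGroup.mk a) = QuotientGroup.mk (e a) :=
  rfl

/-- A group isomorphism induces an isomorphism of coset graphs. -/
def cosetGraphIso {G K : Type*} [Group G] [Group K] (e : G ≃* K) (H : Subgroup G) (U : Set G) :
    cosetGraph H U ≃g cosetGraph (H.map e.toMonoidHom) (e '' U) where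
  toEquiv := quotientMapEquiv e H
  map_rel_iff' {x y} := by
    have key (x y : G ⧸ H) :
        (∃ k₁ k₂ : K, QuotientGroup.mk k₁ = quotientMapEquiv e H x ∧
          QuotientGroup.mk k₂ = quotientMapEquiv e H y ∧ k₁⁻¹ * k₂ ∈ e '' U) ↔
        ∃ g₁ g₂ : G, QuotientGroup.mk g₁ = x ∧ QuotientGroup.mk g₂ = y ∧ g₁⁻¹ * g₂ ∈ U := by
      simp_rw [e.surjective.exists, ← quotientMapEquiv_mk, (quotientMapEquiv e H).apply_eq_iff_eq,
        ← map_inv, ← map_mul, e.injective.mem_set_image]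
    simp only [cosetGraph, SimpleGraph.fromRel_adj, key, ne_eq,
      (quotientMapEquiv e H).apply_eq_iff_eq]

theorem IsPerfectCodePair.map_mulEquiv {G K : Type*} [Group G] [Group K] {H A : Subgroup G}
    (h : IsPerfectCodePair H A) (e : G ≃* K) :
    IsPerfectCodePair (H.map e.toMonoidHom) (A.map e.toMonoidHom) := by
  obtain ⟨U, hU, hHU, hinv, hcode⟩ := h
  have hcoe (B : Subgroup G) : (B.map e.toMonoidHom : Set K) = e '' (B : Set G) := rfl
  refine ⟨e '' U, ?_, ?_, ?_, ?_⟩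
  · rw [hcoe, ← Set.image_mul, ← Set.image_mul, hU]
  · rw [hcoe, ← Set.image_inter e.injective, hHU, Set.image_empty]
  · rw [← Set.image_inv, hinv]
  · convert hcode.image_iso (cosetGraphIso e H U) using 1
    rw [hcoe, Set.image_image, Set.image_image]
    rfl

/-- if `A` is a perfect code of `(G,H)`, then for every `g ∈ G` the
conjugate `g⁻¹Ag` is a perfect code of `(G, g⁻¹Hg)`. -/
theorem perfectCodePair_conj
    {G : Type*} [Group G] [Finite G] (H A : Subgroup G) (hHA : H ≤ A)
    (h : IsPerfectCodePair H A) (g : G) :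
    IsPerfectCodePair (Subgroup.map (MulAut.conj g⁻¹).toMonoidHom H)
      (Subgroup.map (MulAut.conj g⁻¹).toMonoidHom A) := by
  exact h.map_mulEquiv (MulAut.conj g⁻¹)
end

section
/- Let G be a finite group with a normal subgroup K and a subgroup L such that G = KL and K ∩ L = {1}, and let H ≤ A ≤ L be subgroups. Then A is a perfect code of the pair (G,H) if and only if A is a perfect code of the pair (L,H). -/
open scoped Pointwise

lemma cosetGraph_adj_mk_s6 {G : Type*} [Group G] {H : Subgroup G} {U : Set G}
    (hl : ∀ h ∈ H, ∀ u ∈ U, h * u ∈ U) (hr : ∀ u ∈ U, ∀ h ∈ H, u * h ∈ U)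
    (hinv : ∀ u ∈ U, u⁻¹ ∈ U) (hH : ∀ u ∈ U, u ∉ H) (x y : G) :
    (cosetGraph H U).Adj (x : G ⧸ H) (y : G ⧸ H) ↔ x⁻¹ * y ∈ U := by
  have key : ∀ x y : G, (∃ g₁ g₂ : G, (g₁ : G ⧸ H) = x ∧ (g₂ : G ⧸ H) = y ∧ g₁⁻¹ * g₂ ∈ U) →
      x⁻¹ * y ∈ U := by
    rintro x y ⟨g₁, g₂, h₁, h₂, hU⟩
    have := hr _ (hl _ (H.inv_mem (QuotientGroup.eq.1 h₁)) _ hU) _ (QuotientGroup.eq.1 h₂)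
    simpa [mul_assoc] using this
  rw [cosetGraph, SimpleGraph.fromRel_adj]
  constructor
  · rintro ⟨-, h | h⟩
    · exact key _ _ h
    · simpa using hinv _ (key _ _ h)
  · exact fun h => ⟨fun e => hH _ h (QuotientGroup.eq.1 e), .inl ⟨x, y, rfl, rfl, h⟩⟩

/-- A perfect code of a pair, described by a subset of the group: `U` is a symmetric union of
double cosets of `H`, disjoint from `A`, meeting every left coset of `A` other than `A` itself
in exactly one left coset of `H`. -/
lemma isPerfectCodePair_iff {G : Type*} [Group G] {H A : Subgroup G} (hHA : H ≤ A) :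
    IsPerfectCodePair H A ↔ ∃ U : Set G,
      (∀ h ∈ H, ∀ u ∈ U, h * u ∈ U) ∧ (∀ u ∈ U, ∀ h ∈ H, u * h ∈ U) ∧
      (∀ u ∈ U, u⁻¹ ∈ U) ∧ (∀ u ∈ U, u ∉ A) ∧
      ∀ g ∉ A, ∃ a ∈ A, g * a ∈ U ∧ ∀ b ∈ A, g * b ∈ U → a⁻¹ * b ∈ H := by
  have hmem : ∀ g : G, (g : G ⧸ H) ∈ (QuotientGroup.mk : G → G ⧸ H) '' (A : Set G) ↔ g ∈ A := by
    intro g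
    constructor
    · rintro ⟨a, ha, e⟩
      simpa using A.mul_mem ha (hHA (QuotientGroup.eq.1 e))
    · exact fun h => ⟨g, h, rfl⟩
  constructor
  · rintro ⟨U, hU, hHU, hinv, hindep, hcode⟩
    have hl : ∀ h ∈ H, ∀ u ∈ U, h * u ∈ U := fun h hh u hu => by
      rw [← hU]
      exact ⟨h * u, ⟨h, hh, u, hu, rfl⟩, 1, H.one_mem, mul_one _⟩
    have hr : ∀ u ∈ U, ∀ h ∈ H, u * h ∈ U := fun u hu h hh => by
      rw [← hU]
      exact ⟨u, ⟨1, H.one_mem, u, hu, one_mul _⟩, h, hh, rfl⟩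
    have hi : ∀ u ∈ U, u⁻¹ ∈ U := fun u hu => by
      rw [← hinv]
      simpa using hu
    have hH : ∀ u ∈ U, u ∉ H := fun u hu hh => by
      have : u ∈ (H : Set G) ∩ U := ⟨hh, hu⟩
      simp [hHU] at this
    have hadj := cosetGraph_adj_mk_s6 hl hr hi hH
    refine ⟨U, hl, hr, hi, fun u hu hA => ?_, fun g hg => ?_⟩
    · exact hindep _ ((hmem 1).2 A.one_mem) _ ((hmem u).2 hA) ((hadj 1 u).2 (by simpa using hu))
    · obtain ⟨-, ⟨⟨a, ha, rfl⟩, hga⟩, huniq⟩ :=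
        hcode (g⁻¹ : G) (fun h => hg (by simpa using (hmem _).1 h))
      refine ⟨a, ha, by simpa using (hadj _ _).1 hga, fun b hb hgb => ?_⟩
      exact QuotientGroup.eq.1
        (huniq b ⟨(hmem b).2 hb, (hadj _ _).2 (by simpa using hgb)⟩).symm
  · rintro ⟨U, hl, hr, hi, hA, hcode⟩
    have hadj := cosetGraph_adj_mk_s6 hl hr hi (fun u hu hh => hA u hu (hHA hh))
    refine ⟨U, ?_, ?_, ?_, ?_, ?_⟩
    · ext x
      constructor
      · rintro ⟨-, ⟨h, hh, u, hu, rfl⟩, k, hk, rfl⟩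
        exact hr _ (hl h hh u hu) k hk
      · exact fun hx => ⟨x, ⟨1, H.one_mem, x, hx, one_mul _⟩, 1, H.one_mem, mul_one _⟩
    · ext x
      simpa using fun hx hu => hA x hu (hHA hx)
    · ext x
      exact ⟨fun h => by simpa using hi _ h, fun h => hi x h⟩
    · rintro - ⟨a, ha, rfl⟩ - ⟨b, hb, rfl⟩ hab
      exact hA _ ((hadj _ _).1 hab) (A.mul_mem (A.inv_mem ha) hb)
    · intro v hv
      induction v using QuotientGroup.induction_on with
      | H g =>
        obtain ⟨a, ha, hga, huniq⟩ := hcode g⁻¹ (fun h => hv ((hmem g).2 (by simpa using h)))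
        refine ⟨a, ⟨(hmem a).2 ha, (hadj _ _).2 hga⟩, ?_⟩
        rintro - ⟨⟨b, hb, rfl⟩, hgb⟩
        exact (QuotientGroup.eq.2 (huniq b hb ((hadj _ _).1 hgb))).symm

lemma IsPerfectCodePair.subgroupOf {G : Type*} [Group G] {H A L : Subgroup G} (hHA : H ≤ A)
    (hAL : A ≤ L) (h : IsPerfectCodePair H A) :
    IsPerfectCodePair (H.subgroupOf L) (A.subgroupOf L) := by
  obtain ⟨U, hl, hr, hi, hA, hcode⟩ := (isPerfectCodePair_iff hHA).1 h
  refine (isPerfectCodePair_iff (Subgroup.comap_mono hHA)).2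
    ⟨{x | (x : G) ∈ U}, fun h hh u hu => hl h hh u hu, fun u hu h hh => hr u hu h hh,
      fun u hu => hi u hu, fun u hu => hA u hu, fun g hg => ?_⟩
  obtain ⟨a, ha, hga, huniq⟩ := hcode g hg
  exact ⟨⟨a, hAL ha⟩, ha, hga, fun b hb hgb => huniq b hb hgb⟩

/-- Perfect codes of a pair in `L` extend along a retraction `π : G →* L`. -/
lemma IsPerfectCodePair.of_retraction {G : Type*} [Group G] {H A L : Subgroup G} (hHA : H ≤ A)
    (hAL : A ≤ L) (π : G →* L) (hπ : ∀ l : L, π l = l)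
    (h : IsPerfectCodePair (H.subgroupOf L) (A.subgroupOf L)) : IsPerfectCodePair H A := by
  have hπ' : ∀ g ∈ A, (π g : G) = g := fun g hg => congrArg Subtype.val (hπ ⟨g, hAL hg⟩)
  have hπH : ∀ g ∈ H, π g ∈ H.subgroupOf L := fun g hg => by
    rwa [Subgroup.mem_subgroupOf, hπ' g (hHA hg)]
  have hπA : ∀ g ∈ A, π g ∈ A.subgroupOf L := fun g hg => by
    rwa [Subgroup.mem_subgroupOf, hπ' g hg]
  have hHA' : H.subgroupOf L ≤ A.subgroupOf L := Subgroup.comap_mono hHA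
  obtain ⟨U, hl, hr, hi, hA, hcode⟩ := (isPerfectCodePair_iff hHA').1 h
  refine (isPerfectCodePair_iff hHA).2
    ⟨{g | π g ∈ U ∨ π g ∈ H.subgroupOf L ∧ g ∉ H}, ?_, ?_, ?_, ?_, ?_⟩
  · rintro h hh u (hu | ⟨hu, hu'⟩)
    · exact .inl (by simpa using hl _ (hπH h hh) _ hu)
    · exact .inr ⟨by simpa using mul_mem (hπH h hh) hu, by rwa [H.mul_mem_cancel_left hh]⟩
  · rintro u (hu | ⟨hu, hu'⟩) h hh
    · exact .inl (by simpa using hr _ hu _ (hπH h hh))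
    · exact .inr ⟨by simpa using mul_mem hu (hπH h hh), by rwa [H.mul_mem_cancel_right hh]⟩
  · rintro u (hu | ⟨hu, hu'⟩)
    · exact .inl (by simpa using hi _ hu)
    · exact .inr ⟨by simpa using inv_mem hu, by simpa using hu'⟩
  · rintro u (hu | ⟨hu, hu'⟩) huA
    · exact hA _ hu (hπA u huA)
    · exact hu' (by rwa [Subgroup.mem_subgroupOf, hπ' u huA] at hu)
  · intro g hg
    by_cases hgA : π g ∈ A.subgroupOf L
    · have hH : ∀ b ∈ A, (π (g * b) ∈ U ∨ π (g * b) ∈ H.subgroupOf L ∧ g * b ∉ H) →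
          (π g : G) * b ∈ H := by
        rintro b hb (hU | ⟨hH, -⟩)
        · exact absurd (by simpa using mul_mem hgA (hπA b hb)) (hA _ hU)
        · rwa [Subgroup.mem_subgroupOf, map_mul, Subgroup.coe_mul, hπ' b hb] at hH
      have ha : (π g : G)⁻¹ ∈ A := inv_mem hgA
      refine ⟨(π g : G)⁻¹, ha, .inr ⟨?_, fun hgH => hg ?_⟩, fun b hb hgb => ?_⟩
      · rw [Subgroup.mem_subgroupOf, map_mul, Subgroup.coe_mul, hπ' _ ha, mul_inv_cancel]
        exact H.one_mem
      · exact (A.mul_mem_cancel_right ha).1 (hHA hgH)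
      · simpa using hH b hb hgb
    · have hU : ∀ b ∈ A, (π (g * b) ∈ U ∨ π (g * b) ∈ H.subgroupOf L ∧ g * b ∉ H) →
          π g * π b ∈ U := by
        rintro b hb (hU | ⟨hH, -⟩)
        · simpa using hU
        · rw [map_mul] at hH
          exact absurd ((mul_mem_cancel_right (hπA b hb)).1 (hHA' hH)) hgA
      obtain ⟨a, ha, hga, huniq⟩ := hcode _ hgA
      refine ⟨a, ha, .inl (by simpa [hπ] using hga), fun b hb hgb => ?_⟩
      simpa [Subgroup.mem_subgroupOf, hπ' b hb] using huniq _ (hπA b hb) (hU b hb hgb)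

lemma Subgroup.IsComplement'.exists_retraction {G : Type*} [Group G] {K L : Subgroup G} [K.Normal]
    (h : K.IsComplement' L) : ∃ π : G →* L, ∀ l : L, π l = l := by
  refine ⟨h.symm.QuotientMulEquiv.toMonoidHom.comp (QuotientGroup.mk' K), fun l => ?_⟩
  exact h.symm.QuotientMulEquiv.apply_symm_apply l

/-- if `K ⊴ G`, `L ≤ G`, `G = KL`, `K ∩ L = 1` and `H ≤ A ≤ L`, then
`A` is a perfect code of `(G,H)` iff `A` is a perfect code of `(L,H)`. -/
theorem perfectCodePair_iff_of_complement
    {G : Type*} [Group G] [Finite G] (K L : Subgroup G) [K.Normal]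
    (hKL : (K : Set G) * (L : Set G) = Set.univ) (hKLbot : K ⊓ L = ⊥)
    (H A : Subgroup G) (hHA : H ≤ A) (hAL : A ≤ L) :
    IsPerfectCodePair H A ↔ IsPerfectCodePair (H.subgroupOf L) (A.subgroupOf L) := by
  constructor
  · exact IsPerfectCodePair.subgroupOf hHA hAL
  · obtain ⟨π, hπ⟩ := (Subgroup.isComplement'_of_disjoint_and_mul_eq_univ
      (disjoint_iff.2 hKLbot) hKL).exists_retraction
    exact IsPerfectCodePair.of_retraction hHA hAL π hπ
end
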